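/- arXiv:2105.00523 — 2 statements merged into one kernel-verified Lean document; each statement's English description precedes it below -/
import Mathlib

section
/- Fix γ ∈ ℝ and define J, H_γ : ℝ⁵ → ℝ in coordinates (x,y,z,u,v) by J(x,y,z,u,v) = (u² + v²)/2 + z and H_γ(x,y,z,u,v) = (xu + yv)/2 + γ·z². Then at every point of ℝ⁵ the identity x·(∂_yJ·∂_zH_γ − ∂_zJ·∂_yH_γ) + y·(∂_zJ·∂_xH_γ − ∂_xJ·∂_zH_γ) + z·(∂_xJ·∂_yH_γ − ∂_yJ·∂_xH_γ) = ∂_uJ·∂_vH_γ − ∂_vJ·∂_uH_γ holds (indeed both sides equal (uy − vx)/2). -/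
/-- Partial derivative of `f : ℝ⁵ → ℝ` in the `i`-th coordinate direction. -/
noncomputable def pd5 (f : (Fin 5 → ℝ) → ℝ) (i : Fin 5) (p : Fin 5 → ℝ) : ℝ :=
  fderiv ℝ f p (Pi.single i 1)

/-- In coordinates `(x,y,z,u,v) = (p 0, p 1, p 2, p 3, p 4)`, the Dullin–Pelayo
momentum map `J = (u² + v²)/2 + z`. -/
noncomputable def dpJ : (Fin 5 → ℝ) → ℝ := fun p => ((p 3) ^ 2 + (p 4) ^ 2) / 2 + p 2

/-- In coordinates `(x,y,z,u,v) = (p 0, p 1, p 2, p 3, p 4)`, the Dullin–Pelayo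
family `H_γ = (xu + yv)/2 + γ·z²`. -/
noncomputable def dpH (γ : ℝ) : (Fin 5 → ℝ) → ℝ :=
  fun p => (p 0 * p 3 + p 1 * p 4) / 2 + γ * (p 2) ^ 2

theorem pd5_dpJ (i : Fin 5) (p : Fin 5 → ℝ) :
    pd5 dpJ i p = ![0, 0, 1, p 3, p 4] i := by
  have hd (j : Fin 5) := hasFDerivAt_apply (𝕜 := ℝ) j p
  have h : HasFDerivAt dpJ _ p :=
    ((((hd 3).pow 2).add ((hd 4).pow 2)).mul_const (2⁻¹ : ℝ)).add (hd 2)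
  rw [pd5, h.fderiv]
  fin_cases i <;> simp

theorem pd5_dpH (γ : ℝ) (i : Fin 5) (p : Fin 5 → ℝ) :
    pd5 (dpH γ) i p = ![p 3 / 2, p 4 / 2, 2 * γ * p 2, p 0 / 2, p 1 / 2] i := by
  have hd (j : Fin 5) := hasFDerivAt_apply (𝕜 := ℝ) j p
  have h : HasFDerivAt (dpH γ) _ p :=
    ((((hd 0).mul (hd 3)).add ((hd 1).mul (hd 4))).mul_const (2⁻¹ : ℝ)).add
      (((hd 2).pow 2).const_mul γ)
  rw [pd5, h.fderiv]
  fin_cases i <;> simp <;> ring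

/-- At every point of `ℝ⁵`, with `J = (u²+v²)/2 + z` and
`H_γ = (xu+yv)/2 + γz²`, the identity
`x(∂_yJ·∂_zH − ∂_zJ·∂_yH) + y(∂_zJ·∂_xH − ∂_xJ·∂_zH) + z(∂_xJ·∂_yH − ∂_yJ·∂_xH)
 = ∂_uJ·∂_vH − ∂_vJ·∂_uH` holds; indeed both sides equal `(uy − vx)/2`.
This expresses that `J` and `H_γ` Poisson-commute on `S² × ℝ²`. -/
theorem dullin_pelayo_poisson_commute (γ : ℝ) (p : Fin 5 → ℝ) :
    p 0 * (pd5 dpJ 1 p * pd5 (dpH γ) 2 p - pd5 dpJ 2 p * pd5 (dpH γ) 1 p) +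
        p 1 * (pd5 dpJ 2 p * pd5 (dpH γ) 0 p - pd5 dpJ 0 p * pd5 (dpH γ) 2 p) +
        p 2 * (pd5 dpJ 0 p * pd5 (dpH γ) 1 p - pd5 dpJ 1 p * pd5 (dpH γ) 0 p) =
      pd5 dpJ 3 p * pd5 (dpH γ) 4 p - pd5 dpJ 4 p * pd5 (dpH γ) 3 p ∧
    pd5 dpJ 3 p * pd5 (dpH γ) 4 p - pd5 dpJ 4 p * pd5 (dpH γ) 3 p =
      (p 3 * p 1 - p 4 * p 0) / 2 := by
  simp only [pd5_dpJ, pd5_dpH, Matrix.cons_val]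
  constructor <;> ring
end

section
/- Define J, H : ℝ³ × ℝ³ → ℝ in coordinates ((x₁,y₁,z₁),(x₂,y₂,z₂)) by J = z₁ + 2z₂ and H = (x₁² − y₁²)·x₂ + 2·x₁y₁·y₂ (which equals Re((x₁ + i y₁)²·(x₂ − i y₂))). Then at every point of ℝ⁶ one has x₁(∂_{y₁}J·∂_{z₁}H − ∂_{z₁}J·∂_{y₁}H) + y₁(∂_{z₁}J·∂_{x₁}H − ∂_{x₁}J·∂_{z₁}H) + z₁(∂_{x₁}J·∂_{y₁}H − ∂_{y₁}J·∂_{x₁}H) + x₂(∂_{y₂}J·∂_{z₂}H − ∂_{z₂}J·∂_{y₂}H) + y₂(∂_{z₂}J·∂_{x₂}H − ∂_{x₂}J·∂_{z₂}H) + z₂(∂_{x₂}J·∂_{y₂}H − ∂_{y₂}J·∂_{x₂}H) = 0. -/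
/-- Partial derivative of `f : ℝ⁶ → ℝ` in the `i`-th coordinate direction. -/
noncomputable def pd6 (f : (Fin 6 → ℝ) → ℝ) (i : Fin 6) (p : Fin 6 → ℝ) : ℝ :=
  fderiv ℝ f p (Pi.single i 1)

/-- In coordinates `(x₁,y₁,z₁,x₂,y₂,z₂) = (p 0, …, p 5)`, the
Martynchuk–Efstathiou momentum map `J = z₁ + 2z₂`. -/
noncomputable def meJ : (Fin 6 → ℝ) → ℝ := fun p => p 2 + 2 * p 5

/-- In coordinates `(x₁,y₁,z₁,x₂,y₂,z₂) = (p 0, …, p 5)`, the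
Martynchuk–Efstathiou integral
`H = (x₁² − y₁²)·x₂ + 2·x₁y₁·y₂ = Re((x₁+iy₁)²(x₂−iy₂))`. -/
noncomputable def meH : (Fin 6 → ℝ) → ℝ :=
  fun p => ((p 0) ^ 2 - (p 1) ^ 2) * p 3 + 2 * p 0 * p 1 * p 4

/-- The partial derivatives of `meJ`. -/
theorem pd6_meJ (i : Fin 6) (p : Fin 6 → ℝ) :
    pd6 meJ i p = (Pi.single i 1 : Fin 6 → ℝ) 2 + 2 * (Pi.single i 1 : Fin 6 → ℝ) 5 := by
  have hJ : HasFDerivAt meJ _ p :=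
    (hasFDerivAt_apply (𝕜 := ℝ) 2 p).add ((hasFDerivAt_apply (𝕜 := ℝ) 5 p).const_mul 2)
  simp [pd6, hJ.fderiv]

/-- The partial derivatives of `meH`. -/
theorem pd6_meH (i : Fin 6) (p : Fin 6 → ℝ) :
    pd6 meH i p =
      2 * (p 0 * p 3 + p 1 * p 4) * (Pi.single i 1 : Fin 6 → ℝ) 0 +
        2 * (p 0 * p 4 - p 1 * p 3) * (Pi.single i 1 : Fin 6 → ℝ) 1 +
        (p 0 ^ 2 - p 1 ^ 2) * (Pi.single i 1 : Fin 6 → ℝ) 3 +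
        2 * p 0 * p 1 * (Pi.single i 1 : Fin 6 → ℝ) 4 := by
  have hx (j : Fin 6) := hasFDerivAt_apply (𝕜 := ℝ) (F' := fun _ : Fin 6 => ℝ) j p
  have hH : HasFDerivAt meH _ p :=
    ((((hx 0).pow 2).sub ((hx 1).pow 2)).mul (hx 3)).add
      ((((hx 0).const_mul 2).mul (hx 1)).mul (hx 4))
  simp [pd6, hH.fderiv]
  ring

/-- At every point of `ℝ⁶`, the `so(3)* × so(3)*` Lie–Poisson bracket of
`J = z₁ + 2z₂` and `H = Re((x₁+iy₁)²(x₂−iy₂))` vanishes: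
`x₁(∂_{y₁}J·∂_{z₁}H − ∂_{z₁}J·∂_{y₁}H) + y₁(∂_{z₁}J·∂_{x₁}H − ∂_{x₁}J·∂_{z₁}H)
 + z₁(∂_{x₁}J·∂_{y₁}H − ∂_{y₁}J·∂_{x₁}H) + x₂(∂_{y₂}J·∂_{z₂}H − ∂_{z₂}J·∂_{y₂}H)
 + y₂(∂_{z₂}J·∂_{x₂}H − ∂_{x₂}J·∂_{z₂}H) + z₂(∂_{x₂}J·∂_{y₂}H − ∂_{y₂}J·∂_{x₂}H) = 0`. -/
theorem martynchuk_efstathiou_poisson_commute (p : Fin 6 → ℝ) :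
    p 0 * (pd6 meJ 1 p * pd6 meH 2 p - pd6 meJ 2 p * pd6 meH 1 p) +
        p 1 * (pd6 meJ 2 p * pd6 meH 0 p - pd6 meJ 0 p * pd6 meH 2 p) +
        p 2 * (pd6 meJ 0 p * pd6 meH 1 p - pd6 meJ 1 p * pd6 meH 0 p) +
        p 3 * (pd6 meJ 4 p * pd6 meH 5 p - pd6 meJ 5 p * pd6 meH 4 p) +
        p 4 * (pd6 meJ 5 p * pd6 meH 3 p - pd6 meJ 3 p * pd6 meH 5 p) +
        p 5 * (pd6 meJ 3 p * pd6 meH 4 p - pd6 meJ 4 p * pd6 meH 3 p) = 0 := by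
  simp [pd6_meJ, pd6_meH]
  ring
end
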